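/- For every real r > 1 there exists n_0 such that the following holds for all positive integers k, ℓ, m with n = 1+ℓ·∑_{i=1}^k m^i ≥ n_0: if m ≥ r^{√(log_r n)} and 2 ≤ k ≤ √(log_r n), where log_r n = log n/log r, then for every fixed initial mutant x_0 ∈ V_k, the discrete-time Moran process with fitness r on the (k,ℓ,m)-metafunnel started from the state {x_0} has extinction probability at least 1/(r^k·(log n)^{C_r+7}), where C_r = ⌈2·log_r 20⌉. -/

import Mathlib

open Finset

/-- Total fitness of the mutant set `S` (mutants have fitness `r`, non-mutants fitness `1`). -/
noncomputable def moranW {V : Type*} [Fintype V] (r : ℝ) (S : Finset V) : ℝ :=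
  r * S.card + ((Fintype.card V : ℝ) - S.card)

/-- One-step transition probability of the Moran process with fitness `r` and
reproduction weights `w`, from mutant set `S` to mutant set `T`:  a vertex `u` is chosen
with probability `r / moranW r S` if it is a mutant and `1 / moranW r S` otherwise, then a
target `v` is chosen with probability `w u v`, and `v` becomes a mutant if `u` is one and
a non-mutant otherwise. -/
noncomputable def moranStep {V : Type*} [Fintype V] [DecidableEq V]
    (r : ℝ) (w : V → V → ℝ) (S T : Finset V) : ℝ :=
  ∑ u : V, ∑ v : V,
    ((if u ∈ S then r else 1) / moranW r S) * w u v *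
      (if (if u ∈ S then insert v S else S.erase v) = T then 1 else 0)

/-- Distribution of the Moran process after `t` steps, from initial distribution `init`. -/
noncomputable def moranDist {V : Type*} [Fintype V] [DecidableEq V]
    (r : ℝ) (w : V → V → ℝ) (init : Finset V → ℝ) : ℕ → Finset V → ℝ
  | 0 => init
  | t + 1 => fun T => ∑ S : Finset V, moranDist r w init t S * moranStep r w S T

/-- Reproduction weights of the (unweighted) Moran process on the digraph with
out-neighbourhoods `out`: the offspring goes to a uniformly random out-neighbour. -/
noncomputable def outWeights {V : Type*} [DecidableEq V]
    (out : V → Finset V) : V → V → ℝ :=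
  fun u v => if v ∈ out u then ((out u).card : ℝ)⁻¹ else 0

/-- Extinction probability: `sup_t Pr(S_t = ∅)`. -/
noncomputable def extinctionProb {V : Type*} [Fintype V] [DecidableEq V]
    (r : ℝ) (w : V → V → ℝ) (init : Finset V → ℝ) : ℝ :=
  ⨆ t : ℕ, moranDist r w init t (∅ : Finset V)

/-- Fixation probability: `sup_t Pr(S_t = V)`. -/
noncomputable def fixationProb {V : Type*} [Fintype V] [DecidableEq V]
    (r : ℝ) (w : V → V → ℝ) (init : Finset V → ℝ) : ℝ :=
  ⨆ t : ℕ, moranDist r w init t (Finset.univ : Finset V)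

/-- Initial distribution: a single mutant at a uniformly random vertex. -/
noncomputable def uniformSingleton (V : Type*) [Fintype V] [DecidableEq V] :
    Finset V → ℝ :=
  fun S => if S.card = 1 then (Fintype.card V : ℝ)⁻¹ else 0

/-- Initial distribution: a single mutant at the fixed vertex `x₀`. -/
def pointInit {V : Type*} [DecidableEq V] (x₀ : V) : Finset V → ℝ :=
  fun S => if S = {x₀} then 1 else 0

/-- Vertices of the `(k,ℓ,m)`-metafunnel: the centre `v*` (`Sum.inl ()`) together with,
for each level index `i : Fin k` (representing level `i+1`) and each copy `j : Fin ℓ`,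
a set `V_{i+1,j}` of `m ^ (i+1)` vertices.  It has `1 + ℓ·∑_{i=1}^k m^i` vertices. -/
abbrev MetafunnelV (k ℓ m : ℕ) : Type :=
  Unit ⊕ (Σ i : Fin k, Fin ℓ × Fin (m ^ ((i : ℕ) + 1)))

/-- The level of a metafunnel vertex: the centre has level `0` and the vertices of
`V_{i,j}` have level `i`. -/
def mfLevel {k ℓ m : ℕ} : MetafunnelV k ℓ m → ℕ
  | Sum.inl _ => 0
  | Sum.inr ⟨i, _⟩ => (i : ℕ) + 1

/-- The copy of a metafunnel vertex: `some j` for a vertex of `V_{i,j}`, and `none` for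
the centre. -/
def mfCopy {k ℓ m : ℕ} : MetafunnelV k ℓ m → Option (Fin ℓ)
  | Sum.inl _ => none
  | Sum.inr ⟨_, j, _⟩ => some j

/-- Out-neighbourhoods of the `(k,ℓ,m)`-metafunnel: the centre points to all of `V_k`,
each vertex of `V_1` points to the centre, and each vertex of `V_{i+1,j}` points to all
of `V_{i,j}`. -/
def metafunnelOut (k ℓ m : ℕ) : MetafunnelV k ℓ m → Finset (MetafunnelV k ℓ m)
  | Sum.inl _ => Finset.univ.filter fun v => mfLevel v = k
  | Sum.inr ⟨i, j, _⟩ =>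
      if (i : ℕ) = 0 then {Sum.inl ()}
      else Finset.univ.filter fun v => mfLevel v = (i : ℕ) ∧ mfCopy v = some j

section Abstract

variable {V : Type*} [Fintype V] [DecidableEq V]

lemma aux_W_pos [Nonempty V] {r : ℝ} (hr : 1 < r) (S : Finset V) : 0 < moranW r S := by
  unfold moranW
  have h1 : (S.card : ℝ) ≤ Fintype.card V := by exact_mod_cast S.card_le_univ
  have h2 : (0 : ℝ) < Fintype.card V := by exact_mod_cast Fintype.card_pos
  have h3 : (0 : ℝ) ≤ S.card := by positivity
  nlinarith

lemma aux_step_apply (r : ℝ) (w : V → V → ℝ) (S : Finset V) (f : Finset V → ℝ) :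
    ∑ T : Finset V, moranStep r w S T * f T =
      ∑ u : V, ∑ v : V, ((if u ∈ S then r else 1) / moranW r S) * w u v *
        f (if u ∈ S then insert v S else S.erase v) := by
  unfold moranStep
  simp_rw [Finset.sum_mul]
  rw [Finset.sum_comm]
  refine Finset.sum_congr rfl fun u _ => ?_
  rw [Finset.sum_comm]
  refine Finset.sum_congr rfl fun v _ => ?_
  simp [mul_assoc]

lemma aux_fit_sum (r : ℝ) (S : Finset V) :
    ∑ u : V, (if u ∈ S then r else 1) = moranW r S := by
  unfold moranW
  have : ∀ u : V, (if u ∈ S then r else 1) = 1 + (if u ∈ S then r - 1 else 0) := by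
    intro u; split_ifs <;> ring
  simp_rw [this]
  rw [Finset.sum_add_distrib]
  simp
  ring

lemma aux_step_sum [Nonempty V] {r : ℝ} (hr : 1 < r) (w : V → V → ℝ)
    (hw1 : ∀ u, ∑ v, w u v = 1) (S : Finset V) :
    ∑ T : Finset V, moranStep r w S T = 1 := by
  have h := aux_step_apply r w S (fun _ => 1)
  simp only [mul_one] at h
  rw [h]
  simp_rw [← Finset.mul_sum, hw1, mul_one]
  rw [← Finset.sum_div, aux_fit_sum]
  exact div_self (aux_W_pos hr S).ne'

lemma aux_step_nonneg [Nonempty V] {r : ℝ} (hr : 1 < r) (w : V → V → ℝ)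
    (hw0 : ∀ u v, 0 ≤ w u v) (S T : Finset V) : 0 ≤ moranStep r w S T := by
  unfold moranStep
  refine Finset.sum_nonneg fun u _ => Finset.sum_nonneg fun v _ => ?_
  have := aux_W_pos hr S
  have := hw0 u v
  have : (0 : ℝ) ≤ if u ∈ S then r else 1 := by split_ifs <;> linarith
  have : (0 : ℝ) ≤ (if (if u ∈ S then insert v S else S.erase v) = T then 1 else 0) := by
    split_ifs <;> norm_num
  positivity

lemma aux_step_drift [Nonempty V] {r : ℝ} (hr : 1 < r) (w : V → V → ℝ)
    (hw1 : ∀ u, ∑ v, w u v = 1) (S : Finset V) (g : Finset V → ℝ) :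
    ∑ T : Finset V, moranStep r w S T * g T = g S + (moranW r S)⁻¹ *
      ∑ u : V, ∑ v : V, (if u ∈ S then r else 1) * w u v *
        (g (if u ∈ S then insert v S else S.erase v) - g S) := by
  have h : g S = ∑ T : Finset V, moranStep r w S T * g S := by
    rw [← Finset.sum_mul, aux_step_sum hr w hw1, one_mul]
  rw [← sub_eq_iff_eq_add']
  conv_lhs => rw [h]
  rw [← Finset.sum_sub_distrib]
  simp_rw [← mul_sub]
  rw [aux_step_apply r w S (fun T => g T - g S), Finset.mul_sum]
  refine Finset.sum_congr rfl fun u _ => ?_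
  rw [Finset.mul_sum]
  refine Finset.sum_congr rfl fun v _ => ?_
  ring

lemma aux_dist_nonneg [Nonempty V] {r : ℝ} (hr : 1 < r) (w : V → V → ℝ)
    (hw0 : ∀ u v, 0 ≤ w u v) (x : V) (t : ℕ) (S : Finset V) :
    0 ≤ moranDist r w (pointInit x) t S := by
  induction t generalizing S with
  | zero => simp only [moranDist, pointInit]; split_ifs <;> norm_num
  | succ t ih =>
    simp only [moranDist]
    exact Finset.sum_nonneg fun T _ => mul_nonneg (ih T) (aux_step_nonneg hr w hw0 _ _)

lemma aux_dist_succ (r : ℝ) (w : V → V → ℝ) (x : V) (t : ℕ) (f : Finset V → ℝ) :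
    ∑ S, moranDist r w (pointInit x) (t + 1) S * f S =
      ∑ S, moranDist r w (pointInit x) t S * ∑ T, moranStep r w S T * f T := by
  simp only [moranDist]
  simp_rw [Finset.sum_mul, Finset.mul_sum]
  rw [Finset.sum_comm]
  simp_rw [mul_assoc]

lemma aux_dist_sum [Nonempty V] {r : ℝ} (hr : 1 < r) (w : V → V → ℝ)
    (hw1 : ∀ u, ∑ v, w u v = 1) (x : V) (t : ℕ) :
    ∑ S, moranDist r w (pointInit x) t S = 1 := by
  induction t with
  | zero => simp [moranDist, pointInit]
  | succ t ih =>
    have := aux_dist_succ r w x t (fun _ => 1)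
    simp only [mul_one, aux_step_sum hr w hw1] at this
    rw [this, ih]

/-- Lower bound on the extinction probability by a truncated strict submartingale. -/
lemma aux_extinction_ge {r : ℝ} (hr : 1 < r) (w : V → V → ℝ)
    (hw0 : ∀ u v, 0 ≤ w u v) (hw1 : ∀ u, ∑ v, w u v = 1) (x : V) (g : Finset V → ℝ)
    (hg1 : ∀ S, g S ≤ 1)
    (hg : ∀ S, S ≠ ∅ → 0 < g S →
      0 < ∑ u : V, ∑ v : V, (if u ∈ S then r else 1) * w u v *
        (g (if u ∈ S then insert v S else S.erase v) - g S)) :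
    g {x} ≤ extinctionProb r w (pointInit x) := by
  haveI : Nonempty V := ⟨x⟩
  set P := moranDist r w (pointInit x) with hP
  have hP0 : ∀ t S, 0 ≤ P t S := aux_dist_nonneg hr w hw0 x
  have hP1 : ∀ t, ∑ S, P t S = 1 := aux_dist_sum hr w hw1 x
  have hPle : ∀ t S, P t S ≤ 1 := fun t S => by
    rw [← hP1 t]; exact Finset.single_le_sum (fun T _ => hP0 t T) (Finset.mem_univ S)
  have hbdd : BddAbove (Set.range fun t => P t ∅) := ⟨1, by rintro _ ⟨t, rfl⟩; exact hPle t ∅⟩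
  set e := extinctionProb r w (pointInit x) with he
  have hPe : ∀ t, P t ∅ ≤ e := fun t => le_ciSup hbdd t
  have he0 : 0 ≤ e := le_trans (hP0 0 ∅) (hPe 0)
  by_contra hcon
  push Not at hcon
  let f : Finset V → ℝ := fun S => max (g S) 0
  let B : Finset V → Prop := fun S => S ≠ ∅ ∧ 0 < g S
  classical
  obtain ⟨κ, hκ0, hκ⟩ : ∃ κ : ℝ, 0 < κ ∧ ∀ S, B S →
      g S + κ ≤ ∑ T : Finset V, moranStep r w S T * g T := by
    by_cases hne : (Finset.univ.filter B).Nonempty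
    · obtain ⟨S₀, hS₀, hmin⟩ := Finset.exists_min_image (Finset.univ.filter B)
        (fun S => (∑ T : Finset V, moranStep r w S T * g T) - g S) hne
      refine ⟨(∑ T : Finset V, moranStep r w S₀ T * g T) - g S₀, ?_, ?_⟩
      · rw [aux_step_drift hr w hw1]
        have hB := (Finset.mem_filter.mp hS₀).2
        have := hg S₀ hB.1 hB.2
        have hW := aux_W_pos hr S₀
        rw [add_sub_cancel_left]
        positivity
      · intro S hS
        have := hmin S (by simp [hS])
        linarith
    · refine ⟨1, one_pos, fun S hS => ?_⟩
      exact absurd ⟨S, by simp [hS]⟩ hne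
  have hPf : ∀ S, f S + (if B S then κ else 0) ≤ ∑ T : Finset V, moranStep r w S T * f T := by
    intro S
    by_cases hB : B S
    · rw [if_pos hB]
      have : f S = g S := max_eq_left hB.2.le
      rw [this]
      refine (hκ S hB).trans (Finset.sum_le_sum fun T _ => ?_)
      exact mul_le_mul_of_nonneg_left (le_max_left _ _) (aux_step_nonneg hr w hw0 _ _)
    · rw [if_neg hB, add_zero]
      by_cases hS : S = ∅
      · subst hS
        rw [aux_step_drift hr w hw1]
        simp
      · have : f S = 0 := max_eq_right (not_lt.mp fun h => hB ⟨hS, h⟩)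
        rw [this]
        exact Finset.sum_nonneg fun T _ =>
          mul_nonneg (aux_step_nonneg hr w hw0 _ _) (le_max_right _ _)
  have hf1 : ∀ S, f S ≤ 1 := fun S => max_le (hg1 S) zero_le_one
  let E : ℕ → ℝ := fun t => ∑ S, P t S * f S
  have hE1 : ∀ t, E t ≤ 1 := fun t => by
    rw [← hP1 t]
    exact Finset.sum_le_sum fun S _ => mul_le_of_le_one_right (hP0 t S) (hf1 S)
  have hE0 : g {x} ≤ E 0 := by
    have : E 0 = f {x} := by simp [E, hP, moranDist, pointInit]
    rw [this]; exact le_max_left _ _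
  have hEB : ∀ t, E t ≤ P t ∅ + ∑ S, P t S * (if B S then 1 else 0) := by
    intro t
    have : P t ∅ = ∑ S, P t S * (if S = ∅ then 1 else 0) := by simp
    rw [this, ← Finset.sum_add_distrib]
    refine Finset.sum_le_sum fun S _ => ?_
    rw [← mul_add]
    refine mul_le_mul_of_nonneg_left ?_ (hP0 t S)
    by_cases hS : S = ∅
    · have := hf1 S
      rw [if_pos hS]; split_ifs <;> linarith
    · by_cases hB : B S
      · have := hf1 S
        rw [if_pos hB]; split_ifs <;> linarith
      · have : f S = 0 := max_eq_right (not_lt.mp fun h => hB ⟨hS, h⟩)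
        rw [this]; split_ifs <;> norm_num
  have hEs : ∀ t, E t + κ * ∑ S, P t S * (if B S then 1 else 0) ≤ E (t + 1) := by
    intro t
    have : E (t + 1) = _ := aux_dist_succ r w x t f
    rw [this, Finset.mul_sum, ← Finset.sum_add_distrib]
    refine Finset.sum_le_sum fun S _ => ?_
    have h1 := mul_le_mul_of_nonneg_left (hPf S) (hP0 t S)
    refine le_trans (le_of_eq ?_) h1
    split_ifs <;> ring
  have hgrow : ∀ t : ℕ, g {x} + t * (κ * (g {x} - e)) ≤ E t := by
    intro t
    induction t with
    | zero => simpa using hE0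
    | succ t ih =>
      have h1 := hEs t
      have h2 := hEB t
      have h3 := hPe t
      have h5 : 0 ≤ (t : ℝ) * (κ * (g {x} - e)) := by
        have : 0 < g {x} - e := by linarith
        positivity
      have h4 : g {x} - e ≤ ∑ S, P t S * (if B S then 1 else 0) := by linarith
      have h6 := mul_le_mul_of_nonneg_left h4 hκ0.le
      push_cast
      linarith
  obtain ⟨t, ht⟩ := exists_nat_gt ((1 - g {x}) / (κ * (g {x} - e)))
  have hpos : 0 < κ * (g {x} - e) := mul_pos hκ0 (by linarith)
  rw [div_lt_iff₀ hpos] at ht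
  have := hgrow t
  have := hE1 t
  linarith

/-- Drift of a multiplicative function. -/
lemma aux_drift_prod (r : ℝ) (w : V → V → ℝ) (a : V → ℝ) (ha : ∀ v, 0 < a v) (S : Finset V) :
    ∑ u : V, ∑ v : V, (if u ∈ S then r else 1) * w u v *
        ((∏ y ∈ (if u ∈ S then insert v S else S.erase v), a y) - ∏ y ∈ S, a y) =
      (∏ y ∈ S, a y) * ∑ u ∈ S, (r * (∑ v, if v ∈ S then 0 else w u v * (a v - 1)) +
        ((a u)⁻¹ - 1) * ∑ y, if y ∈ S then 0 else w y u) := by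
  have hins : ∀ v, (∏ y ∈ insert v S, a y) - ∏ y ∈ S, a y =
      (∏ y ∈ S, a y) * (if v ∈ S then 0 else (a v - 1)) := by
    intro v
    by_cases hv : v ∈ S
    · simp [hv]
    · rw [Finset.prod_insert hv, if_neg hv]; ring
  have her : ∀ v, (∏ y ∈ S.erase v, a y) - ∏ y ∈ S, a y =
      (∏ y ∈ S, a y) * (if v ∈ S then ((a v)⁻¹ - 1) else 0) := by
    intro v
    by_cases hv : v ∈ S
    · rw [← Finset.mul_prod_erase S a hv, if_pos hv]
      have := (ha v).ne'
      field_simp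
    · simp [hv]
  have h1 : ∀ u v, (if u ∈ S then r else 1) * w u v *
        ((∏ y ∈ (if u ∈ S then insert v S else S.erase v), a y) - ∏ y ∈ S, a y) =
      (∏ y ∈ S, a y) * ((if u ∈ S then r * (if v ∈ S then 0 else w u v * (a v - 1)) else 0) +
        (if v ∈ S then ((a v)⁻¹ - 1) * (if u ∈ S then 0 else w u v) else 0)) := by
    intro u v
    by_cases hu : u ∈ S
    · simp only [hu, if_true, hins]
      split_ifs <;> ring
    · simp only [hu, if_false, her]
      split_ifs <;> ring
  simp_rw [h1, ← Finset.mul_sum]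
  congr 1
  simp_rw [Finset.sum_add_distrib]
  have hS : ∀ F : V → ℝ, ∑ u ∈ S, F u = ∑ u, if u ∈ S then F u else 0 := by
    intro F; simp [Finset.sum_ite_mem]
  rw [hS, hS]
  congr 1
  · refine Finset.sum_congr rfl fun u _ => ?_
    by_cases hu : u ∈ S
    · simp only [hu, if_true, Finset.mul_sum]
    · simp [hu]
  · rw [Finset.sum_comm]
    refine Finset.sum_congr rfl fun u _ => ?_
    by_cases hu : u ∈ S
    · simp only [hu, if_true, Finset.mul_sum]
    · simp [hu]

end Abstract

section Layered

variable {V : Type*} [Fintype V] [DecidableEq V]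

set_option maxHeartbeats 4000000 in
lemma aux_layered {r : ℝ} (hr : 1 < r) (w : V → V → ℝ)
    (hw0 : ∀ u v, 0 ≤ w u v) (hw1 : ∀ u, ∑ v, w u v = 1)
    (lev : V → ℕ) (k : ℕ) (hk : 2 ≤ k) (hlev : ∀ v, lev v ≤ k)
    (hc : ∀ u v, lev u = 0 → lev v = 0 → u = v)
    (hnext0 : ∀ u v, lev u = 0 → w u v ≠ 0 → lev v = k)
    (hnext : ∀ u v, lev u ≠ 0 → w u v ≠ 0 → lev v + 1 = lev u)
    (m l N M c X : ℝ) (hl : 1 ≤ l) (hN0 : 0 ≤ N) (hM : M = m - N) (hM4 : 4 * r ≤ M)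
    (hmid : ∀ v, lev v ≠ 0 → lev v < k → m ≤ ∑ u, w u v)
    (hcen : ∀ v, lev v = 0 → l * m ≤ ∑ u, w u v)
    (htop : ∀ u v, lev u = 0 → lev v = k → (l * m ^ k)⁻¹ ≤ w u v)
    (hexc : ∃ u, lev u = 0)
    (hX : X = 8 * r ^ (k + 1) * (m / M) ^ k)
    (hc0 : 0 < c) (hcX : c * (1 + X) ≤ (l * m ^ k)⁻¹)
    (hcN : ∀ j : ℕ, c * 2 ^ j < 1 → (j : ℝ) + 2 ≤ N)
    (x₀ : V) (hx₀ : lev x₀ = k) :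
    (1 + X)⁻¹ / 2 - c ≤ extinctionProb r w (pointInit x₀) := by
  have hr0 : 0 < r := by linarith
  have hM0 : 0 < M := by linarith
  have hm0 : 0 < m := by linarith
  have hmM : 1 ≤ m / M := by rw [le_div_iff₀ hM0]; linarith
  have hl0 : 0 < l := by linarith
  have hX1 : 1 ≤ X := by
    rw [hX]
    have h1 : 1 ≤ r ^ (k + 1) := one_le_pow₀ hr.le
    have h2 : 1 ≤ (m / M) ^ k := one_le_pow₀ hmM
    nlinarith
  -- the parameters
  obtain ⟨x, hxk, hx⟩ : ∃ x : ℕ → ℝ, x k = X ∧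
      ∀ i, i ≠ k → x i = 4 * r / (l * M) * (r / M) ^ i :=
    ⟨fun i => if i = k then X else 4 * r / (l * M) * (r / M) ^ i, by simp,
      fun i hi => by simp [hi]⟩
  have hxpos : ∀ i, 0 < x i := by
    intro i
    by_cases hi : i = k
    · rw [hi, hxk]; linarith
    · rw [hx i hi]; positivity
  let q : V → ℝ := fun v => (1 + x (lev v))⁻¹
  have hq0 : ∀ v, 0 < q v := fun v => by have := hxpos (lev v); positivity
  have hq1 : ∀ v, q v ≤ 1 := fun v =>
    inv_le_one_of_one_le₀ (by have := hxpos (lev v); linarith)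
  have hqx : ∀ v, 1 - x (lev v) ≤ q v := by
    intro v
    have := hxpos (lev v)
    simp only [q]
    rw [← one_div, le_div_iff₀ (by linarith)]
    nlinarith
  let A : V → ℝ := fun v => if lev v ≠ 0 ∧ lev v < k then 2 else 1
  have hA1 : ∀ v, 1 ≤ A v := fun v => by simp only [A]; split_ifs <;> norm_num
  have hA0 : ∀ v, 0 < A v := fun v => by linarith [hA1 v]
  let g : Finset V → ℝ := fun S => (∏ v ∈ S, q v) - (1 + X)⁻¹ / 2 - c * ∏ v ∈ S, A v
  have hgx : g {x₀} = (1 + X)⁻¹ / 2 - c := by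
    simp only [g, Finset.prod_singleton, q, A, hx₀, hxk]
    simp
    ring
  rw [← hgx]
  have hGle1 : ∀ S : Finset V, ∏ v ∈ S, q v ≤ 1 := fun S =>
    Finset.prod_le_one (fun v _ => (hq0 v).le) (fun v _ => hq1 v)
  have hXinv : 0 < (1 + X)⁻¹ := by positivity
  have hPsi1 : ∀ S : Finset V, 1 ≤ ∏ v ∈ S, A v := fun S => by
    simpa using Finset.prod_le_prod (s := S) (f := fun _ => (1 : ℝ)) (g := A)
      (fun _ _ => zero_le_one) (fun v _ => hA1 v)
  refine aux_extinction_ge hr w hw0 hw1 x₀ g ?_ ?_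
  · intro S
    have h1 := hGle1 S
    have h2 := hPsi1 S
    have h3 : 0 < c * ∏ v ∈ S, A v := by positivity
    simp only [g]
    linarith
  intro S hS hgS
  set G := ∏ v ∈ S, q v with hG
  set Ψ := ∏ v ∈ S, A v with hΨ
  have hΨ1 : 1 ≤ Ψ := hPsi1 S
  have hGpos : 0 < G := Finset.prod_pos fun v _ => hq0 v
  have hcΨ : 0 < c * Ψ := by positivity
  have hGgt : (1 + X)⁻¹ / 2 + c * Ψ < G := by
    simp only [g] at hgS; linarith
  -- at most one top-level mutant
  have hone : ∀ y ∈ S, ∀ z ∈ S, lev y = k → lev z = k → y = z := by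
    intro y hy z hz hyk hzk
    by_contra hne
    have h1 : G ≤ q y * q z := by
      rw [← Finset.prod_pair hne]
      refine Finset.prod_le_prod_of_subset_of_le_one ?_ (fun v _ => (hq0 v).le)
        (fun v _ _ => hq1 v)
      intro v hv
      simp only [Finset.mem_insert, Finset.mem_singleton] at hv
      rcases hv with rfl | rfl <;> assumption
    have h2 : q y * q z ≤ (1 + X)⁻¹ / 2 := by
      simp only [q, hyk, hzk, hxk]
      have : (1 + X)⁻¹ ≤ 1 / 2 := by
        rw [inv_le_comm₀ (by linarith) (by norm_num)]; linarith
      nlinarith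
    linarith
  -- size bound
  have hcard : (S.card : ℝ) ≤ N := by
    let T := S.filter fun v => lev v ≠ 0 ∧ lev v < k
    have hT : Ψ = 2 ^ T.card := by
      rw [hΨ, Finset.prod_ite]
      simp [T]
    have h1 := hcN T.card (by rw [← hT]; have := hGle1 S; linarith)
    have h2 : S.card ≤ T.card + 2 := by
      have hsub : S ⊆ T ∪ (S.filter (fun v => lev v = 0) ∪ S.filter (fun v => lev v = k)) := by
        intro v hv
        have := hlev v
        simp only [T, Finset.mem_union, Finset.mem_filter, hv, true_and]
        omega
      have h3 : (S.filter (fun v => lev v = 0)).card ≤ 1 := by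
        rw [Finset.card_le_one]
        intro a ha b hb
        exact hc a b (Finset.mem_filter.mp ha).2 (Finset.mem_filter.mp hb).2
      have h4 : (S.filter (fun v => lev v = k)).card ≤ 1 := by
        rw [Finset.card_le_one]
        intro a ha b hb
        rw [Finset.mem_filter] at ha hb
        exact hone a ha.1 b hb.1 ha.2 hb.2
      have h5 := Finset.card_le_card hsub
      have h6 := Finset.card_union_le T
        (S.filter (fun v => lev v = 0) ∪ S.filter (fun v => lev v = k))
      have h7 := Finset.card_union_le (S.filter (fun v => lev v = 0))
        (S.filter (fun v => lev v = k))
      omega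
    have h3 : (S.card : ℝ) ≤ T.card + 2 := by exact_mod_cast h2
    linarith
  -- death rates
  let d : V → ℝ := fun v => ∑ u, if u ∈ S then 0 else w u v
  have hw_le : ∀ u v, w u v ≤ 1 := fun u v => by
    rw [← hw1 u]; exact Finset.single_le_sum (fun y _ => hw0 u y) (Finset.mem_univ v)
  have hd0 : ∀ v, 0 ≤ d v := fun v => Finset.sum_nonneg fun u _ => by
    split_ifs
    · exact le_rfl
    · exact hw0 u v
  have hd : ∀ v, (∑ u, w u v) - N ≤ d v := by
    intro v
    have h1 : ∑ u, w u v ≤ d v + ∑ u, if u ∈ S then (1 : ℝ) else 0 := by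
      rw [← Finset.sum_add_distrib]
      refine Finset.sum_le_sum fun u _ => ?_
      have := hw_le u v
      split_ifs <;> linarith
    have h2 : (∑ u, if u ∈ S then (1 : ℝ) else 0) = S.card := by simp
    linarith
  -- per-vertex terms
  let tG : V → ℝ := fun u => r * (∑ v, if v ∈ S then 0 else w u v * (q v - 1)) +
        ((q u)⁻¹ - 1) * d u
  let tA : V → ℝ := fun u => r * (∑ v, if v ∈ S then 0 else w u v * (A v - 1)) +
        ((A u)⁻¹ - 1) * d u
  have hdrift : ∑ u : V, ∑ v : V, (if u ∈ S then r else 1) * w u v *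
        (g (if u ∈ S then insert v S else S.erase v) - g S) =
      ∑ u ∈ S, (G * tG u - c * Ψ * tA u) := by
    have e1 := aux_drift_prod r w q hq0 S
    have e2 := aux_drift_prod r w A hA0 S
    rw [Finset.sum_sub_distrib, ← Finset.mul_sum, ← Finset.mul_sum, mul_assoc]
    simp only [tG, tA, d]
    rw [hG, hΨ, ← e1, ← e2, Finset.mul_sum, ← Finset.sum_sub_distrib]
    refine Finset.sum_congr rfl fun u _ => ?_
    rw [Finset.mul_sum, ← Finset.sum_sub_distrib]
    refine Finset.sum_congr rfl fun v _ => ?_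
    simp only [g]
    ring
  rw [hdrift]
  have hbG : ∀ (u : V) (y : ℝ), 0 ≤ y → (∀ v, w u v ≠ 0 → 1 - y ≤ q v) →
      -y ≤ ∑ v, if v ∈ S then 0 else w u v * (q v - 1) := by
    intro u y hy hv
    have : -y = ∑ v, w u v * (-y) := by rw [← Finset.sum_mul, hw1, one_mul]
    rw [this]
    refine Finset.sum_le_sum fun v _ => ?_
    have h0 := hw0 u v
    split_ifs
    · nlinarith
    · by_cases h : w u v = 0
      · simp [h]
      · have := hv v h
        exact mul_le_mul_of_nonneg_left (by linarith) h0
  have hbA : ∀ (u : V) (y : ℝ), 0 ≤ y → (∀ v, w u v ≠ 0 → A v - 1 ≤ y) →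
      (∑ v, if v ∈ S then 0 else w u v * (A v - 1)) ≤ y := by
    intro u y hy hv
    have : y = ∑ v, w u v * y := by rw [← Finset.sum_mul, hw1, one_mul]
    rw [this]
    refine Finset.sum_le_sum fun v _ => ?_
    have h0 := hw0 u v
    split_ifs
    · positivity
    · by_cases h : w u v = 0
      · simp [h]
      · exact mul_le_mul_of_nonneg_left (hv v h) h0
  have hqinv : ∀ u, (q u)⁻¹ - 1 = x (lev u) := fun u => by simp [q]
  have hA_le : ∀ v, A v - 1 ≤ 1 := fun v => by simp only [A]; split_ifs <;> norm_num
  -- centre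
  have hG0 : ∀ u, lev u = 0 → 3 * r ≤ tG u := by
    intro u hu
    have h1 := hbG u 1 zero_le_one (fun v _ => by linarith [hq0 v])
    have h2 := hd u
    have h3 := hcen u hu
    have h4 : l * M ≤ d u := by rw [hM]; nlinarith
    have h5 : 4 * r ≤ x (lev u) * d u := by
      rw [hu, hx 0 (by omega), pow_zero, mul_one]
      calc 4 * r = 4 * r / (l * M) * (l * M) := by field_simp
        _ ≤ _ := mul_le_mul_of_nonneg_left h4 (by positivity)
    simp only [tG]
    rw [hqinv]
    nlinarith
  have hA0' : ∀ u, lev u = 0 → tA u ≤ 0 := by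
    intro u hu
    have h1 := hbA u 0 le_rfl (fun v hv => by
      have := hnext0 u v hu hv
      simp [A, this])
    simp only [tA]
    have : A u = 1 := by simp [A, hu]
    rw [this]
    nlinarith
  -- middle
  have hGm : ∀ u, lev u ≠ 0 → lev u < k → 0 ≤ tG u := by
    intro u hu huk
    obtain ⟨i, hi⟩ := Nat.exists_eq_succ_of_ne_zero hu
    have h1 := hbG u (x i) (hxpos i).le (fun v hv => by
      have := hnext u v hu hv
      have h : lev v = i := by omega
      rw [← h]; exact hqx v)
    have h2 := hd u
    have h3 := hmid u hu huk
    have h4 : M ≤ d u := by linarith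
    have h5 : r * x i ≤ x (lev u) * d u := by
      have e : r * x i = x (lev u) * M := by
        rw [hi, hx i (by omega), hx _ (by omega), Nat.succ_eq_add_one, pow_succ]
        field_simp
      rw [e]
      exact mul_le_mul_of_nonneg_left h4 (hxpos _).le
    simp only [tG]
    rw [hqinv]
    nlinarith
  have hAm : ∀ u, lev u ≠ 0 → lev u < k → tA u ≤ -r := by
    intro u hu huk
    have h1 := hbA u 1 zero_le_one (fun v _ => hA_le v)
    have h2 := hd u
    have h3 := hmid u hu huk
    have h4 : M ≤ d u := by linarith
    simp only [tA]
    have : A u = 2 := by simp [A, hu, huk]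
    rw [this]
    nlinarith
  -- top
  have hAk : ∀ u, lev u = k → tA u ≤ r := by
    intro u hu
    have h1 := hbA u 1 zero_le_one (fun v _ => hA_le v)
    simp only [tA]
    have : A u = 1 := by simp [A, hu]
    rw [this]
    nlinarith
  obtain ⟨k', hk'⟩ : ∃ k', k = k' + 1 := ⟨k - 1, by omega⟩
  have hxk' : r * x k' = 4 * r ^ (k + 1) / (l * M ^ k) := by
    rw [hx k' (by omega), hk', div_pow]
    field_simp
    try ring
  have hxk1 : x k' ≤ 1 := by
    rw [hx k' (by omega)]
    have h1 : r / M ≤ 1 := by rw [div_le_one hM0]; linarith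
    have h2 : (r / M) ^ k' ≤ 1 := pow_le_one₀ (by positivity) h1
    have h3 : 4 * r / (l * M) ≤ 1 := by
      rw [div_le_one (by positivity)]; nlinarith
    have h4 : 0 ≤ 4 * r / (l * M) := by positivity
    have h5 : 0 ≤ (r / M) ^ k' := by positivity
    nlinarith
  have hsumk : ∀ u, lev u = k → -(x k') ≤ ∑ v, if v ∈ S then 0 else w u v * (q v - 1) := by
    intro u hu
    refine hbG u (x k') (hxpos _).le (fun v hv => ?_)
    have := hnext u v (by omega) hv
    have h : lev v = k' := by omega
    rw [← h]; exact hqx v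
  have hGk1 : ∀ u, lev u = k → -r ≤ tG u := by
    intro u hu
    have h1 := hsumk u hu
    have h2 := hd0 u
    have h3 := hxpos (lev u)
    have h4 : 0 ≤ x (lev u) * d u := by positivity
    simp only [tG]
    rw [hqinv]
    nlinarith
  have hGk0 : ∀ u, lev u = k → (∀ v ∈ S, lev v ≠ 0) → 4 * r * (l * m ^ k)⁻¹ ≤ tG u := by
    intro u hu hcS
    obtain ⟨v₀, hv₀⟩ := hexc
    have h1 := hsumk u hu
    have h2 : (l * m ^ k)⁻¹ ≤ d u := by
      refine (htop v₀ u hv₀ hu).trans ?_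
      have hn : v₀ ∉ S := fun h => hcS v₀ h hv₀
      have := Finset.single_le_sum (f := fun y => if y ∈ S then 0 else w y u)
        (fun y _ => by
          show 0 ≤ if y ∈ S then 0 else w y u
          split_ifs
          · exact le_rfl
          · exact hw0 y u) (Finset.mem_univ v₀)
      simpa [hn] using this
    have h3 : X * (l * m ^ k)⁻¹ ≤ x (lev u) * d u := by
      rw [hu, hxk]; exact mul_le_mul_of_nonneg_left h2 (by linarith)
    have h4 : X * (l * m ^ k)⁻¹ = 2 * (r * x k') := by
      rw [hxk', hX, div_pow]; field_simp; ring
    have h5 : 4 * r * (l * m ^ k)⁻¹ ≤ r * x k' := by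
      rw [hxk', ← div_eq_mul_inv]
      have a1 : M ^ k ≤ m ^ k := pow_le_pow_left₀ hM0.le (by linarith) k
      have a2 : r ≤ r ^ (k + 1) := le_self_pow₀ hr.le (by omega)
      gcongr
    simp only [tG]
    rw [hqinv]
    nlinarith
  -- conclusion
  have hnon : ∀ u, lev u ≠ k → 0 < G * tG u - c * Ψ * tA u := by
    intro u hu
    by_cases h0 : lev u = 0
    · have h1 := hG0 u h0
      have h2 := hA0' u h0
      nlinarith [mul_pos hGpos hr0]
    · have hlt : lev u < k := lt_of_le_of_ne (hlev u) hu
      have h1 := hGm u h0 hlt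
      have h2 := hAm u h0 hlt
      nlinarith [mul_pos hcΨ hr0, mul_nonneg hGpos.le h1]
  by_cases hex : ∃ y ∈ S, lev y = k
  swap
  · push Not at hex
    exact Finset.sum_pos (fun u hu => hnon u (hex u hu)) (Finset.nonempty_iff_ne_empty.mpr hS)
  obtain ⟨y, hyS, hyk⟩ := hex
  rw [← Finset.add_sum_erase S _ hyS]
  have hrest : ∀ u ∈ S.erase y, 0 < G * tG u - c * Ψ * tA u := fun u hu => by
    rw [Finset.mem_erase] at hu
    exact hnon u fun h => hu.1 (hone u hu.2 y hyS h hyk)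
  have hyA := hAk y hyk
  have hsingle : ∀ u ∈ S.erase y, G * tG u - c * Ψ * tA u ≤
      ∑ u ∈ S.erase y, (G * tG u - c * Ψ * tA u) := fun u hu =>
    Finset.single_le_sum (f := fun u => G * tG u - c * Ψ * tA u)
      (fun v hv => (hrest v hv).le) hu
  by_cases hcS : ∃ u ∈ S, lev u = 0
  · obtain ⟨u, huS, hu⟩ := hcS
    have hmem : u ∈ S.erase y := Finset.mem_erase.mpr ⟨fun h => by rw [h] at hu; omega, huS⟩
    have h1 := hsingle u hmem
    have h2 := hG0 u hu
    have h3 := hA0' u hu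
    have h4 := hGk1 y hyk
    have h5 : G * (3 * r) ≤ G * tG u := mul_le_mul_of_nonneg_left h2 hGpos.le
    have h6 : G * (-r) ≤ G * tG y := mul_le_mul_of_nonneg_left h4 hGpos.le
    have h7 : c * Ψ * tA u ≤ 0 := mul_nonpos_of_nonneg_of_nonpos hcΨ.le h3
    have h8 : c * Ψ * tA y ≤ c * Ψ * r := mul_le_mul_of_nonneg_left hyA hcΨ.le
    have h9 : c * Ψ * r < G * r := mul_lt_mul_of_pos_right (by linarith) hr0
    have h10 : 0 < G * r := by positivity
    linarith
  · push Not at hcS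
    have h4 := hGk0 y hyk hcS
    have h6 : G * (4 * r * (l * m ^ k)⁻¹) ≤ G * tG y := mul_le_mul_of_nonneg_left h4 hGpos.le
    have h8 : c * Ψ * tA y ≤ c * Ψ * r := mul_le_mul_of_nonneg_left hyA hcΨ.le
    have h10 : 0 < G * (4 * r * (l * m ^ k)⁻¹) := by positivity
    by_cases hem : (S.erase y).Nonempty
    · obtain ⟨u, hu⟩ := hem
      have h1 := hsingle u hu
      have huS := Finset.mem_erase.mp hu
      have huk : lev u ≠ k := fun h => huS.1 (hone u huS.2 y hyS h hyk)
      have hlt : lev u < k := lt_of_le_of_ne (hlev u) huk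
      have h2 := hGm u (hcS u huS.2) hlt
      have h3 := hAm u (hcS u huS.2) hlt
      have h5 : 0 ≤ G * tG u := by positivity
      have h7 : c * Ψ * tA u ≤ c * Ψ * (-r) := mul_le_mul_of_nonneg_left h3 hcΨ.le
      linarith
    · rw [Finset.not_nonempty_iff_eq_empty] at hem
      rw [hem, Finset.sum_empty, add_zero]
      have hSy : S = {y} := by
        rw [← Finset.insert_erase hyS, hem]; rfl
      have hΨe : Ψ = 1 := by
        rw [hΨ, hSy, Finset.prod_singleton]; simp [A, hyk]
      rw [hΨe] at h8 ⊢
      have h11 : c ≤ (1 + X)⁻¹ * (l * m ^ k)⁻¹ := by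
        rw [← div_eq_inv_mul, le_div_iff₀ (by linarith)]
        exact hcX
      have h12 : (1 + X)⁻¹ / 2 * (4 * r * (l * m ^ k)⁻¹) ≤ G * (4 * r * (l * m ^ k)⁻¹) :=
        mul_le_mul_of_nonneg_right (by linarith) (by positivity)
      have h13 : c * r ≤ (1 + X)⁻¹ * (l * m ^ k)⁻¹ * r := mul_le_mul_of_nonneg_right h11 hr0.le
      have h14 : 0 < c * r := by positivity
      nlinarith

end Layered

section Metafunnel

lemma aux_card_top (k ℓ m : ℕ) (hk : 0 < k) :
    ((Finset.univ : Finset (MetafunnelV k ℓ m)).filter fun v => mfLevel v = k).card =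
      ℓ * m ^ k := by
  obtain ⟨k', rfl⟩ : ∃ k', k = k' + 1 := ⟨k - 1, by omega⟩
  let e : Fin ℓ × Fin (m ^ (k' + 1)) → MetafunnelV (k' + 1) ℓ m :=
    fun p => Sum.inr ⟨Fin.last k', p⟩
  have he : Function.Injective e := by
    intro a b h
    simpa [e] using h
  have : ((Finset.univ : Finset (MetafunnelV (k' + 1) ℓ m)).filter fun v => mfLevel v = k' + 1) =
      Finset.univ.image e := by
    ext v
    simp only [Finset.mem_filter, Finset.mem_univ, true_and, Finset.mem_image]
    constructor
    · intro h
      match v, h with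
      | Sum.inl _, h => simp [mfLevel] at h
      | Sum.inr ⟨⟨i, hi⟩, p⟩, h =>
        simp only [mfLevel] at h
        obtain rfl : i = k' := by omega
        exact ⟨p, rfl⟩
    · rintro ⟨p, rfl⟩
      simp [e, mfLevel]
  rw [this, Finset.card_image_of_injective _ he]
  simp

lemma aux_card_mid (k ℓ m i : ℕ) (hi : i < k) (j : Fin ℓ) :
    ((Finset.univ : Finset (MetafunnelV k ℓ m)).filter fun v =>
      mfLevel v = i + 1 ∧ mfCopy v = some j).card = m ^ (i + 1) := by
  let e : Fin (m ^ (i + 1)) → MetafunnelV k ℓ m := fun p => Sum.inr ⟨⟨i, hi⟩, j, p⟩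
  have he : Function.Injective e := by
    intro a b h
    simpa [e] using h
  have : ((Finset.univ : Finset (MetafunnelV k ℓ m)).filter fun v =>
      mfLevel v = i + 1 ∧ mfCopy v = some j) = Finset.univ.image e := by
    ext v
    simp only [Finset.mem_filter, Finset.mem_univ, true_and, Finset.mem_image]
    constructor
    · intro h
      match v, h with
      | Sum.inl _, h => simp [mfLevel] at h
      | Sum.inr ⟨⟨i', hi'⟩, j', p⟩, h =>
        simp only [mfLevel, mfCopy, Option.some.injEq] at h
        obtain rfl : i' = i := by omega
        obtain rfl := h.2
        exact ⟨p, rfl⟩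
    · rintro ⟨p, rfl⟩
      simp [e, mfLevel, mfCopy]
  rw [this, Finset.card_image_of_injective _ he]
  simp

lemma aux_card_out_pos (k ℓ m : ℕ) (hk : 0 < k) (hℓ : 0 < ℓ) (hm : 0 < m)
    (u : MetafunnelV k ℓ m) : 0 < (metafunnelOut k ℓ m u).card := by
  match u with
  | Sum.inl _ => simp only [metafunnelOut]; rw [aux_card_top k ℓ m hk]; positivity
  | Sum.inr ⟨⟨0, h⟩, j, _⟩ => simp [metafunnelOut]
  | Sum.inr ⟨⟨i + 1, h⟩, j, _⟩ =>
    simp only [metafunnelOut]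
    rw [if_neg (by omega), aux_card_mid k ℓ m i (by omega) j]
    positivity

lemma aux_weights_sum (k ℓ m : ℕ) (hk : 0 < k) (hℓ : 0 < ℓ) (hm : 0 < m)
    (u : MetafunnelV k ℓ m) : ∑ v, outWeights (metafunnelOut k ℓ m) u v = 1 := by
  have := aux_card_out_pos k ℓ m hk hℓ hm u
  have h' : ((metafunnelOut k ℓ m u).card : ℝ) ≠ 0 := by exact_mod_cast this.ne'
  simp only [outWeights, Finset.sum_ite_mem, Finset.univ_inter, Finset.sum_const, nsmul_eq_mul]
  exact mul_inv_cancel₀ h'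

lemma aux_weights_nonneg (k ℓ m : ℕ) (u v : MetafunnelV k ℓ m) :
    0 ≤ outWeights (metafunnelOut k ℓ m) u v := by
  unfold outWeights; split_ifs <;> positivity

lemma aux_weights_ne (k ℓ m : ℕ) (u v : MetafunnelV k ℓ m)
    (h : outWeights (metafunnelOut k ℓ m) u v ≠ 0) : v ∈ metafunnelOut k ℓ m u := by
  unfold outWeights at h
  by_contra hv
  simp [hv] at h

lemma aux_level_le (k ℓ m : ℕ) (v : MetafunnelV k ℓ m) : mfLevel v ≤ k := by
  match v with
  | Sum.inl _ => simp [mfLevel]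
  | Sum.inr ⟨⟨i, h⟩, _⟩ => simp only [mfLevel]; omega

lemma aux_level_zero (k ℓ m : ℕ) (v : MetafunnelV k ℓ m) (h : mfLevel v = 0) :
    v = Sum.inl () := by
  match v, h with
  | Sum.inl _, _ => rfl
  | Sum.inr ⟨i, _⟩, h => simp [mfLevel] at h

lemma aux_next (k ℓ m : ℕ) (u v : MetafunnelV k ℓ m) (hu : mfLevel u ≠ 0)
    (h : v ∈ metafunnelOut k ℓ m u) : mfLevel v + 1 = mfLevel u := by
  match u, hu, h with
  | Sum.inl _, hu, _ => simp [mfLevel] at hu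
  | Sum.inr ⟨⟨0, h0⟩, j, p⟩, _, h =>
    simp only [metafunnelOut, if_true, Finset.mem_singleton] at h
    subst h
    simp [mfLevel]
  | Sum.inr ⟨⟨i + 1, h0⟩, j, p⟩, _, h =>
    simp only [metafunnelOut] at h
    rw [if_neg (by omega)] at h
    simp only [Finset.mem_filter] at h
    rw [h.2.1]
    simp [mfLevel]

lemma aux_in_mid (k ℓ m : ℕ) (hm : 0 < m) (v : MetafunnelV k ℓ m) (h0 : mfLevel v ≠ 0)
    (hk : mfLevel v < k) : (m : ℝ) ≤ ∑ u, outWeights (metafunnelOut k ℓ m) u v := by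
  match v, h0, hk with
  | Sum.inl _, h0, _ => simp [mfLevel] at h0
  | Sum.inr ⟨⟨i, hi⟩, j, p⟩, _, hk =>
    simp only [mfLevel] at hk
    let e : Fin (m ^ (i + 1 + 1)) → MetafunnelV k ℓ m := fun p => Sum.inr ⟨⟨i + 1, hk⟩, j, p⟩
    have he : Function.Injective e := by
      intro a b h
      simpa [e] using h
    have h1 : ∑ u ∈ Finset.univ.image e, outWeights (metafunnelOut k ℓ m) u
        (Sum.inr ⟨⟨i, hi⟩, j, p⟩) = m := by
      rw [Finset.sum_image (fun a _ b _ h => he h)]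
      have : ∀ y, outWeights (metafunnelOut k ℓ m) (e y) (Sum.inr ⟨⟨i, hi⟩, j, p⟩) =
          ((m : ℝ) ^ (i + 1))⁻¹ := by
        intro y
        have ho : metafunnelOut k ℓ m (e y) = Finset.univ.filter fun v =>
            mfLevel v = i + 1 ∧ mfCopy v = some j := by
          simp only [metafunnelOut, e]
          rw [if_neg (by omega)]
        unfold outWeights
        rw [ho, aux_card_mid k ℓ m i hi j, if_pos (Finset.mem_filter.mpr ⟨Finset.mem_univ _, rfl, rfl⟩)]
        push_cast
        rfl
      simp only [this, Finset.sum_const, Finset.card_univ, Fintype.card_fin, nsmul_eq_mul]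
      have hm' : (m : ℝ) ≠ 0 := by exact_mod_cast hm.ne'
      push_cast
      field_simp
      try ring
    rw [← h1]
    exact Finset.sum_le_sum_of_subset_of_nonneg (Finset.subset_univ _)
      (fun u _ _ => aux_weights_nonneg k ℓ m u _)

lemma aux_in_cen (k ℓ m : ℕ) (hk : 0 < k) (v : MetafunnelV k ℓ m) (h0 : mfLevel v = 0) :
    (ℓ : ℝ) * m ≤ ∑ u, outWeights (metafunnelOut k ℓ m) u v := by
  obtain rfl := aux_level_zero k ℓ m v h0
  let e : Fin ℓ × Fin (m ^ (0 + 1)) → MetafunnelV k ℓ m := fun p => Sum.inr ⟨⟨0, hk⟩, p⟩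
  have he : Function.Injective e := by
    intro a b h
    simpa [e] using h
  have h1 : ∑ u ∈ Finset.univ.image e, outWeights (metafunnelOut k ℓ m) u
      (Sum.inl ()) = ℓ * m := by
    rw [Finset.sum_image (fun a _ b _ h => he h)]
    have : ∀ y, outWeights (metafunnelOut k ℓ m) (e y) (Sum.inl ()) = 1 := by
      rintro ⟨j, y⟩
      simp [outWeights, metafunnelOut, e]
    simp [this]
  rw [← h1]
  exact Finset.sum_le_sum_of_subset_of_nonneg (Finset.subset_univ _)
    (fun u _ _ => aux_weights_nonneg k ℓ m u _)

lemma aux_w_top (k ℓ m : ℕ) (hk : 0 < k) (u v : MetafunnelV k ℓ m) (h0 : mfLevel u = 0)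
    (hv : mfLevel v = k) :
    ((ℓ : ℝ) * m ^ k)⁻¹ ≤ outWeights (metafunnelOut k ℓ m) u v := by
  obtain rfl := aux_level_zero k ℓ m u h0
  have ho : metafunnelOut k ℓ m (Sum.inl ()) = Finset.univ.filter fun v => mfLevel v = k := rfl
  unfold outWeights
  rw [ho, aux_card_top k ℓ m hk, if_pos (by simp [hv])]
  push_cast
  exact le_rfl

lemma aux_asymp (r : ℝ) (hr : 1 < r) : ∃ n₀ : ℕ, ∀ n : ℕ, n₀ ≤ n →
    68 * r ≤ Real.log n ∧ 17 * r ≤ n ∧ 8 * r ≤ r ^ Real.sqrt (Real.log n / Real.log r) ∧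
    2 * Real.sqrt (Real.log n / Real.log r) * (5 * Real.log n + 2) ≤
      r ^ Real.sqrt (Real.log n / Real.log r) := by
  have hlr : 0 < Real.log r := Real.log_pos hr
  have hn : Filter.Tendsto (fun n : ℕ => (n : ℝ)) Filter.atTop Filter.atTop :=
    tendsto_natCast_atTop_atTop
  have hlog := Real.tendsto_log_atTop.comp hn
  have hL : Filter.Tendsto (fun n : ℕ => Real.sqrt (Real.log n / Real.log r))
      Filter.atTop Filter.atTop :=
    Real.tendsto_sqrt_atTop.comp (hlog.atTop_div_const hlr)
  have hexp : ∀ L : ℝ, r ^ L = Real.exp (Real.log r * L) := fun L =>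
    Real.rpow_def_of_pos (by linarith) L
  have h3 : ∀ᶠ L : ℝ in Filter.atTop, 8 * r ≤ r ^ L :=
    (tendsto_rpow_atTop_of_base_gt_one r hr).eventually_ge_atTop _
  have h4 : ∀ᶠ L : ℝ in Filter.atTop,
      2 * L * (5 * (L ^ 2 * Real.log r) + 2) ≤ r ^ L := by
    have ht := (tendsto_exp_mul_div_rpow_atTop 4 (Real.log r) hlr).eventually_ge_atTop 1
    filter_upwards [ht, Filter.eventually_ge_atTop (10 * Real.log r + 4), Filter.eventually_ge_atTop 1]
      with L h1 h2 h3
    rw [hexp]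
    have hL4 : L ^ (4 : ℝ) = L ^ 4 := by exact_mod_cast Real.rpow_natCast L 4
    rw [hL4, le_div_iff₀ (by positivity), one_mul] at h1
    refine le_trans ?_ h1
    have e1 : L ^ 3 * (10 * Real.log r + 4) ≤ L ^ 3 * L :=
      mul_le_mul_of_nonneg_left h2 (by positivity)
    have e2 : L ≤ L ^ 3 := le_self_pow₀ h3 (by norm_num)
    nlinarith
  have key := ((hlog.eventually_ge_atTop (68 * r)).and (hn.eventually_ge_atTop (17 * r))).and
    ((hL.eventually h3).and (hL.eventually h4))
  obtain ⟨n₀, h⟩ := Filter.eventually_atTop.mp key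
  refine ⟨n₀, fun n hn' => ?_⟩
  obtain ⟨⟨a, b⟩, c, d⟩ := h n hn'
  refine ⟨a, b, c, ?_⟩
  have a' : 68 * r ≤ Real.log n := a
  have hsq : Real.sqrt (Real.log n / Real.log r) ^ 2 * Real.log r = Real.log n := by
    rw [Real.sq_sqrt (div_nonneg (by linarith) hlr.le)]
    field_simp
  rwa [hsq] at d

end Metafunnel

/-- **Extinction lower bound for metafunnels, large-`m` regime** (Lemma 5.12).  For
every `r > 1` there is an `n₀` such that for all positive integers `k`, `ℓ`, `m` with
`n` equal to the number of vertices of the `(k,ℓ,m)`-metafunnel and `n ≥ n₀`, if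
`m ≥ r^{√(log_r n)}` and `2 ≤ k ≤ √(log_r n)` (where `log_r n = log n / log r`), then
for every fixed initial mutant `x₀ ∈ V_k`, the discrete-time Moran process with fitness
`r` started from `{x₀}` has extinction probability at least
`1/(r^k · (log n)^{C_r + 7})`, where `C_r = ⌈2·log_r 20⌉`. -/
theorem metafunnel_extinction_large_m (r : ℝ) (hr : 1 < r) :
    ∃ n₀ : ℕ, ∀ k ℓ m : ℕ, 0 < ℓ → 0 < m →
      ∀ n : ℕ, n = Fintype.card (MetafunnelV k ℓ m) → n₀ ≤ n →
        r ^ Real.sqrt (Real.log (n : ℝ) / Real.log r) ≤ (m : ℝ) →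
        2 ≤ k → (k : ℝ) ≤ Real.sqrt (Real.log (n : ℝ) / Real.log r) →
        ∀ x₀ : MetafunnelV k ℓ m, mfLevel x₀ = k →
          ∀ C : ℕ, C = ⌈2 * (Real.log 20 / Real.log r)⌉₊ →
            1 / (r ^ k * Real.log (n : ℝ) ^ (C + 7)) ≤
              extinctionProb r (outWeights (metafunnelOut k ℓ m)) (pointInit x₀) := by
  obtain ⟨n₀, hn₀⟩ := aux_asymp r hr
  refine ⟨n₀, ?_⟩
  intro k ℓ m hℓ hm n hn hnn hmr hk hkL x₀ hx₀ C _
  obtain ⟨hlog, hn17, h8, hbig⟩ := hn₀ n hnn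
  set L := Real.sqrt (Real.log n / Real.log r) with hL
  set lg := Real.log n with hlg
  have hr0 : 0 < r := by linarith
  have hlg0 : 68 ≤ lg := by linarith
  have hn0 : (0 : ℝ) < n := by linarith
  have hk2 : (2 : ℝ) ≤ k := by exact_mod_cast hk
  have hmR : (0 : ℝ) < m := by exact_mod_cast hm
  have hℓR : (1 : ℝ) ≤ ℓ := by exact_mod_cast hℓ
  -- size comparisons
  have htop_le : (ℓ : ℝ) * m ^ k ≤ n := by
    have : ℓ * m ^ k ≤ n := by
      rw [← aux_card_top k ℓ m (by omega), hn]
      exact Finset.card_le_univ _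
    exact_mod_cast this
  have hm_ge1 : (1 : ℝ) ≤ m := by exact_mod_cast hm
  have hm_le : (m : ℝ) ≤ n := by
    have h1 : (m : ℝ) ≤ m ^ k := le_self_pow₀ hm_ge1 (by omega)
    have h2 : (m : ℝ) ^ k ≤ ℓ * m ^ k := le_mul_of_one_le_left (by positivity) hℓR
    linarith
  have hrk : r ^ k ≤ m := by
    refine le_trans ?_ hmr
    rw [← Real.rpow_natCast]
    exact Real.rpow_le_rpow_of_exponent_le hr.le hkL
  set N := 5 * lg + 2 with hN
  have hN0 : 0 < N := by linarith
  have hkN : 2 * (k * N) ≤ (m : ℝ) := by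
    have h1 : (k : ℝ) * N ≤ L * N := mul_le_mul_of_nonneg_right hkL hN0.le
    linarith
  set M := (m : ℝ) - N with hM
  have hMm : (m : ℝ) / 2 ≤ M := by
    have : 2 * N ≤ k * N := mul_le_mul_of_nonneg_right hk2 hN0.le
    linarith
  have hM0 : 0 < M := by linarith
  have hM4 : 4 * r ≤ M := by linarith
  have hratio : ((m : ℝ) / M) ^ k ≤ 2 := by
    have h1 : 1 + (k : ℝ) * (-(N / m)) ≤ (1 + -(N / m)) ^ k := by
      refine one_add_mul_le_pow ?_ k
      have : N / m ≤ 1 := by rw [div_le_one hmR]; linarith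
      linarith
    have h2 : (k : ℝ) * (N / m) ≤ 1 / 2 := by
      rw [← mul_div_assoc, div_le_iff₀ hmR]; linarith
    have h3 : 1 + -(N / m) = M / m := by rw [hM]; field_simp; ring
    rw [h3] at h1
    have h4 : (1 : ℝ) / 2 ≤ (M / m) ^ k := by linarith
    have h5 : ((m : ℝ) / M) ^ k = ((M / m) ^ k)⁻¹ := by rw [← inv_pow, inv_div]
    rw [h5, inv_le_comm₀ (by positivity) (by norm_num)]
    linarith
  obtain ⟨X, hX⟩ : ∃ X, X = 8 * r ^ (k + 1) * ((m : ℝ) / M) ^ k := ⟨_, rfl⟩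
  have hrk1 : 1 ≤ r ^ (k + 1) := one_le_pow₀ hr.le
  have hX0 : 0 < X := by rw [hX]; positivity
  have hX17 : 1 + X ≤ 17 * r ^ (k + 1) := by
    rw [hX]
    have : 8 * r ^ (k + 1) * ((m : ℝ) / M) ^ k ≤ 8 * r ^ (k + 1) * 2 :=
      mul_le_mul_of_nonneg_left hratio (by positivity)
    linarith
  have hXn : 1 + X ≤ (n : ℝ) ^ 2 := by
    have h1 : 17 * r ^ (k + 1) = 17 * r * r ^ k := by ring
    have h2 : 17 * r * r ^ k ≤ n * n :=
      mul_le_mul hn17 (hrk.trans hm_le) (by positivity) hn0.le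
    nlinarith
  have hc0 : 0 < ((n : ℝ) * (1 + X))⁻¹ := by positivity
  have main := aux_layered hr (outWeights (metafunnelOut k ℓ m)) (aux_weights_nonneg k ℓ m)
    (aux_weights_sum k ℓ m (by omega) hℓ hm) mfLevel k hk (aux_level_le k ℓ m)
    (fun u v hu hv => (aux_level_zero k ℓ m u hu).trans (aux_level_zero k ℓ m v hv).symm)
    (fun u v hu h => by
      have h' := aux_weights_ne k ℓ m u v h
      obtain rfl := aux_level_zero k ℓ m u hu
      simpa [metafunnelOut] using h')
    (fun u v hu h => aux_next k ℓ m u v hu (aux_weights_ne k ℓ m u v h))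
    m ℓ N M ((n : ℝ) * (1 + X))⁻¹ X hℓR hN0.le hM hM4
    (aux_in_mid k ℓ m hm) (aux_in_cen k ℓ m (by omega)) (aux_w_top k ℓ m (by omega))
    ⟨Sum.inl (), rfl⟩ hX hc0
    (by
      have h1 : ((n : ℝ) * (1 + X))⁻¹ * (1 + X) = (n : ℝ)⁻¹ := by field_simp
      rw [h1]
      exact inv_anti₀ (by positivity) htop_le)
    (by
      intro j hj
      rw [inv_mul_lt_iff₀ (by positivity), mul_one] at hj
      have h1 : (2 : ℝ) ^ j ≤ (n : ℝ) ^ 3 := by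
        have : (n : ℝ) * (1 + X) ≤ n * n ^ 2 := mul_le_mul_of_nonneg_left hXn hn0.le
        have e : (n : ℝ) * n ^ 2 = n ^ 3 := by ring
        linarith
      have h2 := Real.log_le_log (by positivity) h1
      rw [Real.log_pow, Real.log_pow] at h2
      have h3 := Real.log_two_gt_d9
      have h4 : (0 : ℝ) ≤ j := by positivity
      push_cast at h2
      rw [hN]
      nlinarith)
    x₀ hx₀
  refine le_trans ?_ main
  have e1 : (1 + X)⁻¹ / 2 - ((n : ℝ) * (1 + X))⁻¹ = (1 + X)⁻¹ * (1 / 2 - (n : ℝ)⁻¹) := by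
    rw [mul_inv]; ring
  have e2 : (n : ℝ)⁻¹ ≤ 1 / 4 := by
    rw [inv_le_comm₀ hn0 (by norm_num)]; linarith
  have e3 : (17 * r ^ (k + 1))⁻¹ ≤ (1 + X)⁻¹ := inv_anti₀ (by positivity) hX17
  have e4 : (17 * r ^ (k + 1))⁻¹ * (1 / 4) ≤ (1 + X)⁻¹ * (1 / 2 - (n : ℝ)⁻¹) :=
    mul_le_mul e3 (by linarith) (by norm_num) (by positivity)
  rw [e1]
  refine le_trans ?_ e4
  have e5 : (17 * r ^ (k + 1))⁻¹ * (1 / 4) = 1 / (r ^ k * (68 * r)) := by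
    rw [pow_succ]; field_simp; norm_num
  rw [e5]
  have e6 : lg ≤ lg ^ (C + 7) := le_self_pow₀ (by linarith) (by omega)
  exact one_div_le_one_div_of_le (by positivity)
    (mul_le_mul_of_nonneg_left (hlog.trans e6) (by positivity))
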